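/- Let f ∈ C([0,1]) be time-independent, let u be a classical solution of the bridge equation with forcing term f, and set K = ½𝓛(0) + (1/π⁴)‖f‖², where 𝓛(0) = E(0) − 2⟨u(0,·), f⟩. Then K ≥ 0 and, for every ε > 0 and all 0 ≤ τ ≤ t, ∫_τ^t ‖∂ₜu(s,·)‖ ds ≤ ε(t − τ) + ε/4 + K/ε. -/

import Mathlib

open Real MeasureTheory

noncomputable section

/-- The `L²(0,1)` inner product `⟨u,v⟩`. -/
def ipL2 (u v : ℝ → ℝ) : ℝ := ∫ x in (0:ℝ)..1, u x * v x

/-- The squared `L²(0,1)` norm `‖u‖²`. -/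
def nsqL2 (u : ℝ → ℝ) : ℝ := ∫ x in (0:ℝ)..1, (u x) ^ 2

/-- Partial derivative in time. -/
def Dt (u : ℝ → ℝ → ℝ) : ℝ → ℝ → ℝ := fun t x => deriv (fun s => u s x) t

/-- Partial derivative in space. -/
def Dx (u : ℝ → ℝ → ℝ) : ℝ → ℝ → ℝ := fun t x => deriv (fun y => u t y) x

/-- A classical solution of the suspension-bridge equation
`∂ₜₜu + ∂ₓₓₓₓu + (p − ‖∂ₓu‖²)∂ₓₓu + ∂ₜu + k²u⁺ = f` on `[0,∞) × [0,1]`,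
smooth up to the boundary, with pinned boundary conditions. -/
def IsClassicalSolution (p k : ℝ) (f u : ℝ → ℝ → ℝ) : Prop :=
  ContDiff ℝ (⊤ : ℕ∞) (Function.uncurry u) ∧
  (∀ t ≥ (0:ℝ), ∀ x ∈ Set.Icc (0:ℝ) 1,
    Dt (Dt u) t x + Dx (Dx (Dx (Dx u))) t x
      + (p - nsqL2 (Dx u t)) * Dx (Dx u) t x
      + Dt u t x + k ^ 2 * max (u t x) 0 = f t x) ∧
  (∀ t ≥ (0:ℝ), u t 0 = 0 ∧ u t 1 = 0 ∧ Dx (Dx u) t 0 = 0 ∧ Dx (Dx u) t 1 = 0)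

/-- The energy `E(t) = ‖∂ₜu‖² + ‖∂ₓₓu‖² + ½(‖∂ₓu‖² − p)² + k²‖u⁺‖²`. -/
def energy (p k : ℝ) (u : ℝ → ℝ → ℝ) (t : ℝ) : ℝ :=
  nsqL2 (Dt u t) + nsqL2 (Dx (Dx u) t)
    + (1 / 2) * (nsqL2 (Dx u t) - p) ^ 2 + k ^ 2 * nsqL2 (fun x => max (u t x) 0)

/-- The reduced energy `𝓔(t) = ‖∂ₜu‖² + ‖∂ₓₓu‖²`. -/
def redEnergy (u : ℝ → ℝ → ℝ) (t : ℝ) : ℝ :=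
  nsqL2 (Dt u t) + nsqL2 (Dx (Dx u) t)

open Set Filter Topology
open scoped ContDiff

section UnitInterval

theorem ipL2_deriv_right {a b : ℝ → ℝ} (ha : ContDiff ℝ 1 a) (hb : ContDiff ℝ 1 b)
    (h₀ : a 0 * b 0 = 0) (h₁ : a 1 * b 1 = 0) :
    ipL2 a (deriv b) = -ipL2 (deriv a) b := by
  unfold ipL2
  rw [intervalIntegral.integral_mul_deriv_eq_deriv_mul
    (fun x _ => (ha.differentiable one_ne_zero x).hasDerivAt)
    (fun x _ => (hb.differentiable one_ne_zero x).hasDerivAt)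
    (ha.continuous_deriv_one.intervalIntegrable _ _)
    (hb.continuous_deriv_one.intervalIntegrable _ _), h₀, h₁]
  ring

theorem nsqL2_add_smul {a b : ℝ → ℝ} (ha : Continuous a) (hb : Continuous b) (c : ℝ) :
    nsqL2 (fun x => a x + c * b x) = nsqL2 a + 2 * c * ipL2 a b + c ^ 2 * nsqL2 b := by
  unfold nsqL2 ipL2
  rw [← intervalIntegral.integral_const_mul, ← intervalIntegral.integral_const_mul,
    ← intervalIntegral.integral_add, ← intervalIntegral.integral_add]
  · exact intervalIntegral.integral_congr fun x _ => by ring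
  all_goals exact Continuous.intervalIntegrable (by fun_prop) _ _

theorem nsqL2_nonneg (a : ℝ → ℝ) : 0 ≤ nsqL2 a :=
  intervalIntegral.integral_nonneg zero_le_one fun _ _ => sq_nonneg _

/-- Picone's identity with the comparison function `cos (c (x - 1/2))`, which is positive on
`[0,1]` because `c < π`. -/
theorem sq_mul_nsqL2_le_nsqL2_deriv_of_lt_pi {v : ℝ → ℝ} (hv : ContDiff ℝ 1 v)
    (h₀ : v 0 = 0) (h₁ : v 1 = 0) {c : ℝ} (hc : 0 < c) (hcπ : c < π) :
    c ^ 2 * nsqL2 v ≤ nsqL2 (deriv v) := by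
  have hcos : ∀ x ∈ uIcc (0:ℝ) 1, cos (c * (x - 1 / 2)) ≠ 0 := by
    intro x hx
    rw [uIcc_of_le zero_le_one] at hx
    exact (cos_pos_of_mem_Ioo ⟨by nlinarith [hx.1, hx.2], by nlinarith [hx.1, hx.2]⟩).ne'
  have hv' := hv.continuous_deriv_one
  have hvc := hv.continuous
  have htan : ContinuousOn (fun x => tan (c * (x - 1 / 2))) (uIcc (0:ℝ) 1) := fun x hx =>
    ((continuousAt_tan.2 (hcos x hx)).comp (f := fun x : ℝ => c * (x - 1 / 2))
      (by fun_prop)).continuousWithinAt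
  have hd : ∀ x ∈ uIcc (0:ℝ) 1, HasDerivAt (fun x => c * tan (c * (x - 1 / 2)) * v x ^ 2)
      (((deriv v x) + c * tan (c * (x - 1 / 2)) * v x) ^ 2
        - (deriv v x ^ 2 - c ^ 2 * v x ^ 2)) x := by
    intro x hx
    have h1 : HasDerivAt (fun x : ℝ => c * (x - 1 / 2)) c x :=
      (((hasDerivAt_id x).sub_const (1 / 2)).const_mul c).congr_deriv (mul_one c)
    have h2 := ((hasDerivAt_tan (hcos x hx)).comp x h1).const_mul c
    have h3 := (hv.differentiable one_ne_zero x).hasDerivAt.pow 2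
    have h4 := h2.mul h3
    refine h4.congr_deriv ?_
    have h5 : 1 / cos (c * (x - 1 / 2)) ^ 2 = 1 + tan (c * (x - 1 / 2)) ^ 2 := by
      rw [tan_eq_sin_div_cos, div_pow, one_add_div (pow_ne_zero 2 (hcos x hx)),
        cos_sq_add_sin_sq]
    simp only [Function.comp_apply, h5, Pi.pow_apply]
    push_cast
    ring
  have hsq : IntervalIntegrable
      (fun x => ((deriv v x) + c * tan (c * (x - 1 / 2)) * v x) ^ 2) volume 0 1 :=
    ContinuousOn.intervalIntegrable (by fun_prop)
  have hrest : IntervalIntegrable (fun x => deriv v x ^ 2 - c ^ 2 * v x ^ 2) volume 0 1 :=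
    Continuous.intervalIntegrable (by fun_prop) _ _
  have key := intervalIntegral.integral_eq_sub_of_hasDerivAt hd (hsq.sub hrest)
  have hpos : 0 ≤ ∫ x in (0:ℝ)..1, ((deriv v x) + c * tan (c * (x - 1 / 2)) * v x) ^ 2 :=
    intervalIntegral.integral_nonneg zero_le_one fun _ _ => sq_nonneg _
  rw [intervalIntegral.integral_sub hsq hrest, intervalIntegral.integral_sub
    (Continuous.intervalIntegrable (by fun_prop) _ _)
    (Continuous.intervalIntegrable (by fun_prop) _ _),
    intervalIntegral.integral_const_mul, h₀, h₁] at key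
  unfold nsqL2
  linarith

/-- Poincaré's inequality on `(0,1)` with the sharp constant. -/
theorem pi_sq_mul_nsqL2_le_nsqL2_deriv {v : ℝ → ℝ} (hv : ContDiff ℝ 1 v)
    (h₀ : v 0 = 0) (h₁ : v 1 = 0) : π ^ 2 * nsqL2 v ≤ nsqL2 (deriv v) := by
  have hlim : Tendsto (fun c : ℝ => c ^ 2 * nsqL2 v) (𝓝[<] π) (𝓝 (π ^ 2 * nsqL2 v)) :=
    (Continuous.tendsto (by fun_prop) π).mono_left nhdsWithin_le_nhds
  refine le_of_tendsto hlim ?_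
  filter_upwards [Ioo_mem_nhdsLT pi_pos] with c hc
  exact sq_mul_nsqL2_le_nsqL2_deriv_of_lt_pi hv h₀ h₁ hc.1 hc.2

theorem pi_pow_four_mul_nsqL2_le {v : ℝ → ℝ} (hv : ContDiff ℝ 2 v)
    (h₀ : v 0 = 0) (h₁ : v 1 = 0) : π ^ 4 * nsqL2 v ≤ nsqL2 (deriv (deriv v)) := by
  have hv1 : ContDiff ℝ 1 v := hv.of_le one_le_two
  have hv' : ContDiff ℝ 1 (deriv v) := hv.deriv' (n := 1)
  have hP := pi_sq_mul_nsqL2_le_nsqL2_deriv hv1 h₀ h₁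
  have hibp := ipL2_deriv_right hv' hv1 (by simp [h₀]) (by simp [h₁])
  have hnn := nsqL2_nonneg fun x => deriv (deriv v) x + π ^ 2 * v x
  rw [nsqL2_add_smul hv'.continuous_deriv_one hv1.continuous] at hnn
  have hself : ipL2 (deriv v) (deriv v) = nsqL2 (deriv v) := by
    simp only [ipL2, nsqL2, sq]
  nlinarith [mul_le_mul_of_nonneg_left hP (sq_nonneg π)]

theorem neg_nsqL2_div_le {v f : ℝ → ℝ} (hv : ContDiff ℝ 2 v) (hf : Continuous f)
    (h₀ : v 0 = 0) (h₁ : v 1 = 0) :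
    -(1 / π ^ 4 * nsqL2 f) ≤ nsqL2 (deriv (deriv v)) - 2 * ipL2 v f := by
  have h := pi_pow_four_mul_nsqL2_le hv h₀ h₁
  have hπ : 0 < π ^ 4 := by positivity
  have hnn := nsqL2_nonneg fun x => v x + -(1 / π ^ 4) * f x
  rw [nsqL2_add_smul hv.continuous hf] at hnn
  have h2 := mul_nonneg hπ.le hnn
  have h3 : π ^ 4 * (nsqL2 v + 2 * -(1 / π ^ 4) * ipL2 v f + (-(1 / π ^ 4)) ^ 2 * nsqL2 f)
      = π ^ 4 * nsqL2 v - 2 * ipL2 v f + 1 / π ^ 4 * nsqL2 f := by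
    field_simp
    ring
  linarith

theorem hasDerivAt_integral_of_continuous {F F' : ℝ → ℝ → ℝ} (hF : ∀ t, Continuous (F t))
    (hF' : Continuous (Function.uncurry F'))
    (hd : ∀ t x, HasDerivAt (fun s => F s x) (F' t x) t) (t : ℝ) :
    HasDerivAt (fun s => ∫ x in (0:ℝ)..1, F s x) (∫ x in (0:ℝ)..1, F' t x) t := by
  obtain ⟨C, hC⟩ := ((isCompact_Icc (a := t - 1) (b := t + 1)).prod
    (isCompact_Icc (a := (0:ℝ)) (b := 1))).exists_bound_of_continuousOn hF'.continuousOn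
  refine (intervalIntegral.hasDerivAt_integral_of_dominated_loc_of_deriv_le
    (bound := fun _ => C) (Icc_mem_nhds (sub_one_lt t) (lt_add_one t))
    (Eventually.of_forall fun s => (hF s).aestronglyMeasurable)
    ((hF t).intervalIntegrable _ _)
    (hF'.comp (Continuous.prodMk_right t)).aestronglyMeasurable
    (Eventually.of_forall fun x hx s hs => ?_) intervalIntegrable_const
    (Eventually.of_forall fun x _ s _ => hd s x)).2
  rw [uIoc_of_le zero_le_one] at hx
  exact hC (s, x) ⟨hs, Ioc_subset_Icc_self hx⟩

end UnitInterval

section Smooth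

variable {u : ℝ → ℝ → ℝ}

theorem hasDerivAt_time (hu : ContDiff ℝ ∞ (Function.uncurry u)) (t x : ℝ) :
    HasDerivAt (fun s => u s x) (fderiv ℝ (Function.uncurry u) (t, x) (1, 0)) t :=
  ((hu.differentiable (by simp)) (t, x)).hasFDerivAt.comp_hasDerivAt t (f := fun s => (s, x))
    ((hasDerivAt_id t).prodMk (hasDerivAt_const t x))

theorem hasDerivAt_space (hu : ContDiff ℝ ∞ (Function.uncurry u)) (t x : ℝ) :
    HasDerivAt (fun y => u t y) (fderiv ℝ (Function.uncurry u) (t, x) (0, 1)) x :=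
  ((hu.differentiable (by simp)) (t, x)).hasFDerivAt.comp_hasDerivAt x (f := fun y => (t, y))
    ((hasDerivAt_const x t).prodMk (hasDerivAt_id x))

theorem uncurry_Dt (hu : ContDiff ℝ ∞ (Function.uncurry u)) :
    Function.uncurry (Dt u) = fun z => fderiv ℝ (Function.uncurry u) z (1, 0) :=
  funext fun z => (hasDerivAt_time hu z.1 z.2).deriv

theorem uncurry_Dx (hu : ContDiff ℝ ∞ (Function.uncurry u)) :
    Function.uncurry (Dx u) = fun z => fderiv ℝ (Function.uncurry u) z (0, 1) :=
  funext fun z => (hasDerivAt_space hu z.1 z.2).deriv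

theorem contDiff_Dt (hu : ContDiff ℝ ∞ (Function.uncurry u)) :
    ContDiff ℝ ∞ (Function.uncurry (Dt u)) := by
  rw [uncurry_Dt hu]
  exact (hu.fderiv_right (m := ∞) (by simp)).clm_apply contDiff_const

theorem contDiff_Dx (hu : ContDiff ℝ ∞ (Function.uncurry u)) :
    ContDiff ℝ ∞ (Function.uncurry (Dx u)) := by
  rw [uncurry_Dx hu]
  exact (hu.fderiv_right (m := ∞) (by simp)).clm_apply contDiff_const

theorem contDiff_section (hu : ContDiff ℝ ∞ (Function.uncurry u)) (t : ℝ) :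
    ContDiff ℝ ∞ (u t) :=
  hu.comp (contDiff_prodMk_right t)

theorem hasDerivAt_Dt (hu : ContDiff ℝ ∞ (Function.uncurry u)) (t x : ℝ) :
    HasDerivAt (fun s => u s x) (Dt u t x) t :=
  (hasDerivAt_time hu t x).differentiableAt.hasDerivAt

theorem Dt_Dx (hu : ContDiff ℝ ∞ (Function.uncurry u)) : Dt (Dx u) = Dx (Dt u) := by
  have hfd : Differentiable ℝ (fderiv ℝ (Function.uncurry u)) :=
    (hu.fderiv_right (m := ∞) (by simp)).differentiable (by simp)
  have happ (z v w : ℝ × ℝ) :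
      fderiv ℝ (fun z => fderiv ℝ (Function.uncurry u) z v) z w
        = fderiv ℝ (fderiv ℝ (Function.uncurry u)) z w v := by
    rw [fderiv_clm_apply (hfd z) (differentiableAt_const v)]
    simp
  funext t x
  have h1 : Dt (Dx u) t x = _ := (hasDerivAt_time (contDiff_Dx hu) t x).deriv
  have h2 : Dx (Dt u) t x = _ := (hasDerivAt_space (contDiff_Dt hu) t x).deriv
  rw [h1, h2, uncurry_Dt hu, uncurry_Dx hu, happ, happ]
  exact (contDiff_infty.1 hu 2).contDiffAt.isSymmSndFDerivAt (by simp) _ _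

theorem hasDerivAt_nsqL2 (hu : ContDiff ℝ ∞ (Function.uncurry u)) (t : ℝ) :
    HasDerivAt (fun s => nsqL2 (u s)) (2 * ipL2 (u t) (Dt u t)) t := by
  have hc := hu.continuous
  have hc' := (contDiff_Dt hu).continuous
  unfold nsqL2 ipL2
  rw [← intervalIntegral.integral_const_mul]
  refine hasDerivAt_integral_of_continuous (F' := fun t x => 2 * (u t x * Dt u t x))
    (fun s => (contDiff_section hu s).continuous.pow 2)
    ((hc.mul hc').const_mul 2) (fun t x => ?_) t
  exact ((hasDerivAt_Dt hu t x).pow 2).congr_deriv (by push_cast; ring)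

theorem hasDerivAt_max_zero_sq (y : ℝ) :
    HasDerivAt (fun y : ℝ => max y 0 ^ 2) (2 * max y 0) y := by
  rcases lt_trichotomy y 0 with h | rfl | h
  · rw [max_eq_right h.le, mul_zero]
    refine (hasDerivAt_const y (0:ℝ)).congr_of_eventuallyEq ?_
    filter_upwards [Iio_mem_nhds h] with z hz
    simp [max_eq_right (mem_Iio.1 hz).le]
  · rw [hasDerivAt_iff_isLittleO]
    simp only [max_self, mul_zero, sub_zero, ne_eq, OfNat.ofNat_ne_zero, not_false_eq_true,
      zero_pow, smul_eq_mul]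
    refine Asymptotics.IsBigO.trans_isLittleO (g := fun y : ℝ => y ^ 2) ?_ ?_
    · refine Asymptotics.IsBigO.of_bound 1 (Eventually.of_forall fun z => ?_)
      rw [norm_pow, norm_pow, one_mul]
      refine pow_le_pow_left₀ (norm_nonneg _) ?_ 2
      rw [Real.norm_eq_abs, Real.norm_eq_abs, abs_of_nonneg (le_max_right z 0)]
      exact max_le (le_abs_self z) (abs_nonneg z)
    · exact Asymptotics.isLittleO_pow_id one_lt_two
  · rw [max_eq_left h.le]
    refine ((hasDerivAt_pow 2 y).congr_deriv (by simp)).congr_of_eventuallyEq ?_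
    filter_upwards [Ioi_mem_nhds h] with z hz
    rw [max_eq_left (mem_Ioi.1 hz).le]

theorem hasDerivAt_nsqL2_max (hu : ContDiff ℝ ∞ (Function.uncurry u)) (t : ℝ) :
    HasDerivAt (fun s => nsqL2 fun x => max (u s x) 0)
      (2 * ipL2 (fun x => max (u t x) 0) (Dt u t)) t := by
  have hc := hu.continuous
  have hc' := (contDiff_Dt hu).continuous
  unfold nsqL2 ipL2
  rw [← intervalIntegral.integral_const_mul]
  refine hasDerivAt_integral_of_continuous
    (F' := fun t x => 2 * (max (u t x) 0 * Dt u t x))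
    (fun s => ((contDiff_section hu s).continuous.max continuous_const).pow 2)
    (((hc.max continuous_const).mul hc').const_mul 2) (fun t x => ?_) t
  have h := (hasDerivAt_max_zero_sq (u t x)).comp t (hasDerivAt_Dt hu t x)
  rw [mul_assoc] at h
  exact h

theorem hasDerivAt_ipL2 {f : ℝ → ℝ} (hf : Continuous f)
    (hu : ContDiff ℝ ∞ (Function.uncurry u)) (t : ℝ) :
    HasDerivAt (fun s => ipL2 (u s) f) (ipL2 (Dt u t) f) t := by
  have hc' := (contDiff_Dt hu).continuous
  exact hasDerivAt_integral_of_continuous (F' := fun t x => Dt u t x * f x)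
    (fun s => (contDiff_section hu s).continuous.mul hf)
    (hc'.mul (hf.comp continuous_snd)) (fun t x => (hasDerivAt_Dt hu t x).mul_const (f x)) t

end Smooth

section Lyapunov

variable {p k : ℝ} {f : ℝ → ℝ} {u : ℝ → ℝ → ℝ}

theorem hasDerivAt_lyapunov_of_contDiff (hf : Continuous f)
    (hu : ContDiff ℝ ∞ (Function.uncurry u)) (t : ℝ) :
    HasDerivAt (fun s => energy p k u s - 2 * ipL2 (u s) f)
      (2 * ipL2 (Dt u t) (Dt (Dt u) t) + 2 * ipL2 (Dx (Dx u) t) (Dx (Dx (Dt u)) t)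
        + 2 * (nsqL2 (Dx u t) - p) * ipL2 (Dx u t) (Dx (Dt u) t)
        + 2 * k ^ 2 * ipL2 (fun x => max (u t x) 0) (Dt u t) - 2 * ipL2 (Dt u t) f) t := by
  have h1 := hasDerivAt_nsqL2 (contDiff_Dt hu) t
  have h2 := hasDerivAt_nsqL2 (contDiff_Dx (contDiff_Dx hu)) t
  have h3 := hasDerivAt_nsqL2 (contDiff_Dx hu) t
  rw [Dt_Dx (contDiff_Dx hu), Dt_Dx hu] at h2
  rw [Dt_Dx hu] at h3
  refine ((((h1.add h2).add (((h3.sub_const p).pow 2).const_mul (1 / 2))).add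
    ((hasDerivAt_nsqL2_max hu t).const_mul (k ^ 2))).sub
    ((hasDerivAt_ipL2 hf hu t).const_mul 2)).congr_deriv ?_
  push_cast
  ring

theorem IsClassicalSolution.Dt_boundary (hu : IsClassicalSolution p k (fun _ x => f x) u)
    {t : ℝ} (ht : 0 < t) : Dt u t 0 = 0 ∧ Dt u t 1 = 0 := by
  constructor
  all_goals
    refine ((hasDerivAt_const t (0:ℝ)).congr_of_eventuallyEq ?_).deriv
    filter_upwards [Ioi_mem_nhds ht] with s hs
  exacts [(hu.2.2 s (le_of_lt hs)).1, (hu.2.2 s (le_of_lt hs)).2.1]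

theorem IsClassicalSolution.hasDerivAt_lyapunov (hf : Continuous f)
    (hu : IsClassicalSolution p k (fun _ x => f x) u) {t : ℝ} (ht : 0 < t) :
    HasDerivAt (fun s => energy p k u s - 2 * ipL2 (u s) f) (-2 * nsqL2 (Dt u t)) t := by
  refine (hasDerivAt_lyapunov_of_contDiff hf hu.1 t).congr_deriv ?_
  obtain ⟨hb₀, hb₁⟩ := hu.Dt_boundary ht
  obtain ⟨-, -, hx₀, hx₁⟩ := hu.2.2 t ht.le
  have sm {w : ℝ → ℝ → ℝ} (hw : ContDiff ℝ ∞ (Function.uncurry w)) : ContDiff ℝ 1 (w t) :=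
    (contDiff_section hw t).of_le (by exact_mod_cast le_top)
  have c0 := hu.1
  have c1 := contDiff_Dx c0
  have c2 := contDiff_Dx c1
  have c3 := contDiff_Dx c2
  have c4 := contDiff_Dx c3
  have d0 := contDiff_Dt c0
  have d1 := contDiff_Dx d0
  have d2 := contDiff_Dt d0
  have i1 : ipL2 (Dx (Dx u) t) (Dx (Dx (Dt u)) t) = -ipL2 (Dx (Dx (Dx u)) t) (Dx (Dt u) t) :=
    ipL2_deriv_right (sm c2) (sm d1) (by simp [hx₀]) (by simp [hx₁])
  have i2 : ipL2 (Dx (Dx (Dx u)) t) (Dx (Dt u) t) = -ipL2 (Dx (Dx (Dx (Dx u))) t) (Dt u t) :=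
    ipL2_deriv_right (sm c3) (sm d0) (by simp [hb₀]) (by simp [hb₁])
  have i3 : ipL2 (Dx u t) (Dx (Dt u) t) = -ipL2 (Dx (Dx u) t) (Dt u t) :=
    ipL2_deriv_right (sm c1) (sm d0) (by simp [hb₀]) (by simp [hb₁])
  rw [i1, i2, i3]
  have k0 := (sm c0).continuous
  have k2 := (sm c2).continuous
  have k4 := (sm c4).continuous
  have l0 := (sm d0).continuous
  have l2 := (sm d2).continuous
  have key : ipL2 (Dt u t) (Dt (Dt u) t) + ipL2 (Dx (Dx (Dx (Dx u))) t) (Dt u t)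
      + (p - nsqL2 (Dx u t)) * ipL2 (Dx (Dx u) t) (Dt u t)
      + k ^ 2 * ipL2 (fun x => max (u t x) 0) (Dt u t) + -1 * ipL2 (Dt u t) f
      = -1 * nsqL2 (Dt u t) := by
    generalize hA : p - nsqL2 (Dx u t) = A
    unfold ipL2 nsqL2
    simp only [← intervalIntegral.integral_const_mul]
    rw [← intervalIntegral.integral_add, ← intervalIntegral.integral_add,
      ← intervalIntegral.integral_add, ← intervalIntegral.integral_add]
    · refine intervalIntegral.integral_congr fun x hx => ?_
      rw [uIcc_of_le zero_le_one] at hx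
      have heq := hu.2.1 t ht.le x hx
      rw [hA] at heq
      linear_combination Dt u t x * heq
    all_goals exact Continuous.intervalIntegrable (by fun_prop) _ _
  linear_combination 2 * key

theorem IsClassicalSolution.neg_nsqL2_div_le_lyapunov (hf : Continuous f)
    (hu : IsClassicalSolution p k (fun _ x => f x) u) {t : ℝ} (ht : 0 ≤ t) :
    -(1 / π ^ 4 * nsqL2 f) ≤ energy p k u t - 2 * ipL2 (u t) f := by
  obtain ⟨h₀, h₁, -, -⟩ := hu.2.2 t ht
  have h := neg_nsqL2_div_le
    (contDiff_infty.1 (contDiff_section hu.1 t) 2) hf h₀ h₁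
  have h' : -(1 / π ^ 4 * nsqL2 f) ≤ nsqL2 (Dx (Dx u) t) - 2 * ipL2 (u t) f := h
  have e1 := nsqL2_nonneg (Dt u t)
  have e2 := mul_nonneg (sq_nonneg k) (nsqL2_nonneg fun x => max (u t x) 0)
  unfold energy
  nlinarith [sq_nonneg (nsqL2 (Dx u t) - p)]

theorem IsClassicalSolution.integral_nsqL2_Dt (hf : Continuous f)
    (hu : IsClassicalSolution p k (fun _ x => f x) u) {τ t : ℝ} (hτ : 0 ≤ τ) (hτt : τ ≤ t) :
    2 * ∫ s in τ..t, nsqL2 (Dt u s) =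
      (energy p k u τ - 2 * ipL2 (u τ) f) - (energy p k u t - 2 * ipL2 (u t) f) := by
  have hcont : Continuous fun s => nsqL2 (Dt u s) := continuous_iff_continuousAt.2
    fun s => (hasDerivAt_nsqL2 (contDiff_Dt hu.1) s).continuousAt
  have h := intervalIntegral.integral_eq_sub_of_hasDerivAt_of_le hτt
    (fun s _ => (hasDerivAt_lyapunov_of_contDiff (p := p) (k := k) hf hu.1
      s).continuousAt.continuousWithinAt)
    (fun s hs => hu.hasDerivAt_lyapunov hf (hτ.trans_lt hs.1))
    ((hcont.const_mul (-2)).intervalIntegrable _ _)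
  rw [intervalIntegral.integral_const_mul] at h
  linarith

end Lyapunov

/-- Lemma on the time-integral of `‖∂ₜu‖`: with `K = ½𝓛(0) + (1/π⁴)‖f‖²`, one has
`K ≥ 0` and, for every `ε > 0` and all `0 ≤ τ ≤ t`,
`∫_τ^t ‖∂ₜu(s,·)‖ ds ≤ ε(t−τ) + ε/4 + K/ε`. -/
theorem velocity_integral_bound (p k : ℝ) (f : ℝ → ℝ) (hf : Continuous f)
    (u : ℝ → ℝ → ℝ) (hu : IsClassicalSolution p k (fun _ x => f x) u) :
    0 ≤ (1 / 2) * (energy p k u 0 - 2 * ipL2 (u 0) f) + (1 / π ^ 4) * nsqL2 f ∧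
    ∀ ε > (0:ℝ), ∀ τ t : ℝ, 0 ≤ τ → τ ≤ t →
      (∫ s in τ..t, Real.sqrt (nsqL2 (Dt u s))) ≤
        ε * (t - τ) + ε / 4 +
          ((1 / 2) * (energy p k u 0 - 2 * ipL2 (u 0) f) + (1 / π ^ 4) * nsqL2 f) / ε := by
  set M := 1 / π ^ 4 * nsqL2 f with hM
  have hM₀ : 0 ≤ M := mul_nonneg (by positivity) (nsqL2_nonneg f)
  have hL₀ := hu.neg_nsqL2_div_le_lyapunov hf le_rfl
  refine ⟨by linarith, fun ε hε τ t hτ hτt => ?_⟩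
  have hint := hu.integral_nsqL2_Dt hf le_rfl hτ
  have hint' := hu.integral_nsqL2_Dt hf hτ hτt
  have hLt := hu.neg_nsqL2_div_le_lyapunov hf (hτ.trans hτt)
  have hpos : 0 ≤ ∫ s in (0:ℝ)..τ, nsqL2 (Dt u s) :=
    intervalIntegral.integral_nonneg hτ fun s _ => nsqL2_nonneg _
  have hcont : Continuous fun s => nsqL2 (Dt u s) := continuous_iff_continuousAt.2
    fun s => (hasDerivAt_nsqL2 (contDiff_Dt hu.1) s).continuousAt
  have hamgm : (∫ s in τ..t, √(nsqL2 (Dt u s))) ≤ ∫ s in τ..t, (ε + 1 / ε * nsqL2 (Dt u s)) := by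
    refine intervalIntegral.integral_mono_on hτt (hcont.sqrt.intervalIntegrable _ _)
      (Continuous.intervalIntegrable (by fun_prop) _ _) fun s _ => ?_
    have hs := Real.sq_sqrt (nsqL2_nonneg (Dt u s))
    have hn := Real.sqrt_nonneg (nsqL2 (Dt u s))
    rw [← hs, Real.sqrt_sq hn, div_mul_eq_mul_div, one_mul, ← sub_le_iff_le_add',
      le_div_iff₀ hε]
    nlinarith [sq_nonneg (√(nsqL2 (Dt u s)) - ε / 2)]
  rw [intervalIntegral.integral_add intervalIntegrable_const
    (Continuous.intervalIntegrable (by fun_prop) _ _), intervalIntegral.integral_const,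
    intervalIntegral.integral_const_mul, smul_eq_mul, one_div_mul_eq_div] at hamgm
  have hdiv : (∫ s in τ..t, nsqL2 (Dt u s)) / ε ≤
      ((1 / 2) * (energy p k u 0 - 2 * ipL2 (u 0) f) + M) / ε := by
    gcongr
    linarith
  linarith
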